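/- Let m ≥ 2 and let h₁,…,h_m be even real functions on ℝ, differentiable on ℝ\{0}, such that for some constants C_i > 0 and exponents σ_i > 0, δ_i > 1 with σ := σ₁ + ⋯ + σ_m < 1 one has: |h_i(λ)| ≤ C_i|λ|^{−σ_i} and |h_i′(λ)| ≤ C_i|λ|^{−σ_i−1} for 0 < |λ| ≤ 1, and |h_i(λ)| ≤ C_i|λ|^{−δ_i} and |h_i′(λ)| ≤ C_i|λ|^{−δ_i−1} for |λ| > 1, for all i = 1,…,m. Then for every ε > 0, Δ_W(T) := | S_W(T) − (2π)^{m−1} ∫_ℝ h₁(λ)⋯h_m(λ) dλ | = O(T^{−γ+ε}) as T → ∞, where γ = (1 − σ)/m. -/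

import Mathlib

open MeasureTheory Filter Set Asymptotics Real
open scoped ENNReal Topology

noncomputable section

/-- Fourier transform of an integrable function on ℝ. -/
def hatR (h : ℝ → ℝ) (t : ℝ) : ℂ :=
  ∫ x : ℝ, Complex.exp (Complex.I * x * t) * (h x)

/-- S_W(T) = (1/T)·tr[W_T(h₁)⋯W_T(h_m)], written as the cyclic
multiple integral over [0,T]^m of the product of kernels. -/
def SW (m : ℕ) [NeZero m] (h : Fin m → ℝ → ℝ) (T : ℝ) : ℂ :=
  (T : ℂ)⁻¹ * ∫ u in Set.univ.pi (fun _ : Fin m => Icc (0 : ℝ) T),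
    ∏ i : Fin m, hatR (h i) (u i - u (i + 1))

/-- The trace approximation error for Toeplitz operators. -/
def ΔW (m : ℕ) [NeZero m] (h : Fin m → ℝ → ℝ) (T : ℝ) : ℝ :=
  ‖SW m h T - (((2 * π) ^ (m - 1) * ∫ x : ℝ, ∏ i, h i x : ℝ) : ℂ)‖

/-! ### Integrals of powers -/

lemma enorm_rpow_eq {y : ℝ} (hy : y ≠ 0) (p : ℝ) : ‖y‖ₑ ^ p = ENNReal.ofReal (|y| ^ p) := by
  rw [Real.enorm_eq_ofReal_abs, ENNReal.ofReal_rpow_of_pos (abs_pos.2 hy)]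

lemma measurable_enorm_rpow (p : ℝ) : Measurable (fun y : ℝ => ‖y‖ₑ ^ p) := by
  fun_prop

lemma lint_Ioc_rpow {p : ℝ} (hp : -1 < p) : ∫⁻ y in Ioc (0:ℝ) 1, ‖y‖ₑ ^ p < ⊤ := by
  have h1 : IntegrableOn (fun y : ℝ => y ^ p) (Ioc 0 1) := by
    have := (intervalIntegral.intervalIntegrable_rpow' (a := 0) (b := 1) hp)
    rwa [intervalIntegrable_iff_integrableOn_Ioc_of_le zero_le_one] at this
  refine lt_of_le_of_lt (le_of_eq ?_) h1.hasFiniteIntegral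
  refine setLIntegral_congr_fun measurableSet_Ioc fun y hy => ?_
  have : 0 < y := hy.1
  simp only
  rw [enorm_rpow_eq this.ne', abs_of_pos this, Real.enorm_eq_ofReal (by positivity)]

lemma lint_Ioi_rpow {q : ℝ} (hq : q < -1) {c : ℝ} (hc : 0 < c) :
    ∫⁻ y in Ioi c, ‖y‖ₑ ^ q = ENNReal.ofReal (-c ^ (q + 1) / (q + 1)) := by
  rw [← integral_Ioi_rpow_of_lt hq hc, ofReal_integral_eq_lintegral_ofReal
    (integrableOn_Ioi_rpow_of_lt hq hc)]
  · refine setLIntegral_congr_fun measurableSet_Ioi fun y hy => ?_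
    have : 0 < y := hc.trans hy
    rw [enorm_rpow_eq this.ne', abs_of_pos this]
  · refine (ae_restrict_iff' measurableSet_Ioi).2 (ae_of_all _ fun y hy => ?_)
    have : 0 < y := hc.trans hy
    simp only [Pi.zero_apply]; positivity

lemma lint_Ioi_min {p q : ℝ} (hp : -1 < p) (hq : q < -1) :
    ∫⁻ y in Ioi (0:ℝ), min (‖y‖ₑ ^ p) (‖y‖ₑ ^ q) < ⊤ := by
  rw [← Ioc_union_Ioi_eq_Ioi zero_le_one]
  refine (lintegral_union_le _ _ _).trans_lt ?_
  refine ENNReal.add_lt_top.2 ⟨?_, ?_⟩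
  · exact (lintegral_mono fun y => min_le_left _ _).trans_lt (lint_Ioc_rpow hp)
  · refine (lintegral_mono fun y => min_le_right _ _).trans_lt ?_
    rw [lint_Ioi_rpow hq one_pos]; exact ENNReal.ofReal_lt_top

lemma lint_min {p q : ℝ} (hp : -1 < p) (hq : q < -1) :
    ∫⁻ y : ℝ, min (‖y‖ₑ ^ p) (‖y‖ₑ ^ q) < ⊤ := by
  have h0 : ∫⁻ y in Iio (0:ℝ), min (‖y‖ₑ ^ p) (‖y‖ₑ ^ q) =
      ∫⁻ y in Ioi (0:ℝ), min (‖y‖ₑ ^ p) (‖y‖ₑ ^ q) := by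
    have hmp : MeasurePreserving (fun x : ℝ => -x) := Measure.measurePreserving_neg volume
    have := hmp.setLIntegral_comp_preimage (s := Ioi (0:ℝ)) measurableSet_Ioi
      (f := fun y => min (‖y‖ₑ ^ p) (‖y‖ₑ ^ q)) (by fun_prop)
    rw [← this]
    simp
  rw [← setLIntegral_univ]
  have : (univ : Set ℝ) = (Iio 0 ∪ Ioi 0) ∪ {0} := by
    ext x; simp only [mem_univ, mem_union, mem_Iio, mem_Ioi, mem_singleton_iff, true_iff]
    rcases lt_trichotomy x 0 with h | h | h <;> simp [h]
  rw [this]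
  refine (lintegral_union_le _ _ _).trans_lt (ENNReal.add_lt_top.2 ⟨?_, by simp⟩)
  refine (lintegral_union_le _ _ _).trans_lt ?_
  rw [h0]
  exact ENNReal.add_lt_top.2 ⟨lint_Ioi_min hp hq, lint_Ioi_min hp hq⟩

lemma enn_rpow_anti {x y : ℝ≥0∞} {b : ℝ} (hb : b ≤ 0) (hxy : x ≤ y) : y ^ b ≤ x ^ b := by
  rw [← neg_neg b, ENNReal.rpow_neg, ENNReal.rpow_neg x]
  exact ENNReal.inv_le_inv.2 (ENNReal.rpow_le_rpow hxy (by linarith))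

/-- `p,q` trick for products of powers. -/
lemma mul_rpow_le_of_le {x y : ℝ≥0∞} (hx0 : x ≠ 0) (hx : x ≠ ⊤) (hxy : x ≤ y) {a b : ℝ} (hb : b ≤ 0) :
    x ^ a * y ^ b ≤ x ^ (a + b) := by
  rw [ENNReal.rpow_add _ _ hx0 hx]
  exact mul_le_mul_right (enn_rpow_anti hb hxy) _

lemma conv_const_fin {a b : ℝ} (ha : 0 < a) (hb : 0 < b) (hab : a + b < 1) :
    ∫⁻ y : ℝ, ‖y‖ₑ ^ (a - 1) * ‖1 - y‖ₑ ^ (b - 1) < ⊤ := by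
  have key : ∀ a b : ℝ, 0 < a → 0 < b → a + b < 1 → ∀ x y : ℝ, x ≠ 0 → |x| ≤ |y| → 1 ≤ |x| + |y| →
      ‖x‖ₑ ^ (a - 1) * ‖y‖ₑ ^ (b - 1) ≤
        2 * min (‖x‖ₑ ^ (a - 1)) (‖x‖ₑ ^ (a - 1 + (b - 1))) := by
    intro a b ha hb hab x y hx0 hxy h1
    have hxy' : ‖x‖ₑ ≤ ‖y‖ₑ := by
      rw [Real.enorm_eq_ofReal_abs, Real.enorm_eq_ofReal_abs]; exact ENNReal.ofReal_le_ofReal hxy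
    have hm := mul_rpow_le_of_le (enorm_ne_zero.2 hx0) enorm_ne_top hxy' (a := a - 1)
      (b := b - 1) (by linarith)
    have hy : 1 / 2 ≤ |y| := by linarith
    have hy2 : ‖y‖ₑ ^ (b - 1) ≤ 2 := by
      have hy0 : y ≠ 0 := by rintro rfl; norm_num at hy
      rw [enorm_rpow_eq hy0]
      rw [show (2 : ℝ≥0∞) = ENNReal.ofReal 2 by simp]
      apply ENNReal.ofReal_le_ofReal
      calc |y| ^ (b - 1) ≤ (1/2 : ℝ) ^ (b - 1) :=
            Real.rpow_le_rpow_of_nonpos (by norm_num) hy (by linarith)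
        _ ≤ (1/2 : ℝ) ^ (-1 : ℝ) :=
            Real.rpow_le_rpow_of_exponent_ge (by norm_num) (by norm_num) (by linarith)
        _ = 2 := by rw [Real.rpow_neg_one]; norm_num
    rcases min_choice (‖x‖ₑ ^ (a - 1)) (‖x‖ₑ ^ (a - 1 + (b - 1))) with h | h <;> rw [h]
    · rw [mul_comm]; gcongr
    · refine hm.trans ?_
      exact le_mul_of_one_le_left zero_le (by norm_num)
  have bound : ∀ᵐ y : ℝ, ‖y‖ₑ ^ (a - 1) * ‖1 - y‖ₑ ^ (b - 1) ≤
      2 * min (‖y‖ₑ ^ (a - 1)) (‖y‖ₑ ^ (a - 1 + (b - 1))) +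
      2 * min (‖1 - y‖ₑ ^ (b - 1)) (‖1 - y‖ₑ ^ (b - 1 + (a - 1))) := by
    have e0 : ∀ᵐ y : ℝ, y ≠ 0 := by simp [ae_iff, measure_singleton]
    have e1 : ∀ᵐ y : ℝ, y ≠ 1 := by simp [ae_iff, measure_singleton]
    filter_upwards [e0, e1] with y h0 h1
    have hs : 1 ≤ |y| + |1 - y| := by
      have := abs_add_le y (1 - y); simpa using this
    rcases le_total |y| |1 - y| with h | h
    · exact (key a b ha hb hab y (1 - y) h0 h hs).trans le_self_add
    · rw [mul_comm (‖y‖ₑ ^ (a - 1))]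
      exact (key b a hb ha (by linarith) (1 - y) y (by intro hh; apply h1; linarith) h
        (by linarith)).trans le_add_self
  refine (lintegral_mono_ae bound).trans_lt ?_
  rw [lintegral_add_left (by fun_prop), lintegral_const_mul _ (by fun_prop),
    lintegral_const_mul _ (by fun_prop)]
  have h2 := lintegral_sub_left_eq_self (μ := (volume : Measure ℝ))
    (fun y : ℝ => min (‖y‖ₑ ^ (b - 1)) (‖y‖ₑ ^ (b - 1 + (a - 1)))) 1
  rw [h2]
  refine ENNReal.add_lt_top.2 ⟨ENNReal.mul_lt_top (by simp) (lint_min (by linarith) (by linarith)),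
    ENNReal.mul_lt_top (by simp) (lint_min (by linarith) (by linarith))⟩

lemma lint_scale {d : ℝ} (hd : d ≠ 0) {F : ℝ → ℝ≥0∞} (hF : Measurable F) :
    ∫⁻ x, F x = ‖d‖ₑ * ∫⁻ y, F (d * y) := by
  have h := Real.smul_map_volume_mul_left hd
  conv_lhs => rw [← h]
  rw [lintegral_smul_measure, lintegral_map hF (by fun_prop), Real.enorm_eq_ofReal_abs]
  rfl

lemma conv_bound {a b : ℝ} (ha : 0 < a) (hb : 0 < b) (hab : a + b < 1) :
    ∃ K : ℝ≥0∞, K ≠ ⊤ ∧ ∀ u v : ℝ,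
      ∫⁻ w : ℝ, ‖u - w‖ₑ ^ (a - 1) * ‖w - v‖ₑ ^ (b - 1) ≤ K * ‖u - v‖ₑ ^ (a + b - 1) := by
  refine ⟨(∫⁻ y : ℝ, ‖y‖ₑ ^ (a - 1) * ‖1 - y‖ₑ ^ (b - 1)) + 1,
    (ENNReal.add_lt_top.2 ⟨conv_const_fin ha hb hab, by simp⟩).ne, fun u v => ?_⟩
  rcases eq_or_ne u v with rfl | huv
  · have : ‖u - u‖ₑ ^ (a + b - 1) = ⊤ := by
      rw [sub_self, enorm_zero, ENNReal.zero_rpow_of_neg (by linarith)]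
    rw [this, ENNReal.mul_top (by simp)]
    exact le_top
  · set d := u - v with hd
    have hd0 : d ≠ 0 := sub_ne_zero.2 huv
    have h2 := lintegral_sub_left_eq_self (μ := (volume : Measure ℝ))
      (fun y : ℝ => ‖y‖ₑ ^ (a - 1) * ‖d - y‖ₑ ^ (b - 1)) u
    have h3 : ∀ w : ℝ, d - (u - w) = w - v := fun w => by rw [hd]; ring
    simp only [h3] at h2
    rw [h2, lint_scale hd0 (by fun_prop)]
    have h4 : ∀ y : ℝ, ‖d * y‖ₑ ^ (a - 1) * ‖d - d * y‖ₑ ^ (b - 1) =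
        ‖d‖ₑ ^ (a - 1 + (b - 1)) * (‖y‖ₑ ^ (a - 1) * ‖1 - y‖ₑ ^ (b - 1)) := by
      intro y
      have hd1 : ‖d‖ₑ ≠ 0 := enorm_ne_zero.2 hd0
      have : d - d * y = d * (1 - y) := by ring
      rw [this, enorm_mul, enorm_mul, ENNReal.rpow_add _ _ hd1 enorm_ne_top,
        ENNReal.mul_rpow_of_ne_top enorm_ne_top enorm_ne_top,
        ENNReal.mul_rpow_of_ne_top enorm_ne_top enorm_ne_top]
      ring
    simp only [h4]
    rw [lintegral_const_mul _ (by fun_prop), ← mul_assoc]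
    have h5 : ‖d‖ₑ * ‖d‖ₑ ^ (a - 1 + (b - 1)) = ‖d‖ₑ ^ (a + b - 1) := by
      conv_lhs => rw [← ENNReal.rpow_one ‖d‖ₑ, ← ENNReal.rpow_mul, ← ENNReal.rpow_add _ _ (enorm_ne_zero.2 hd0) enorm_ne_top]
      congr 1; ring
    rw [h5, mul_comm]
    gcongr
    exact le_self_add
lemma lint_Ioo_rpow {s T : ℝ} (hs : 0 < s) (hT : 0 < T) :
    ∫⁻ u in Ioo (0:ℝ) T, ENNReal.ofReal (u ^ (s - 1)) = ENNReal.ofReal (T ^ s / s) := by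
  have h1 : IntegrableOn (fun y : ℝ => y ^ (s - 1)) (Ioc 0 T) := by
    have := (intervalIntegral.intervalIntegrable_rpow' (a := 0) (b := T) (r := s - 1) (by linarith))
    rwa [intervalIntegrable_iff_integrableOn_Ioc_of_le hT.le] at this
  rw [restrict_Ioo_eq_restrict_Ioc]
  rw [← ofReal_integral_eq_lintegral_ofReal h1]
  · rw [← intervalIntegral.integral_of_le hT.le, integral_rpow (Or.inl (by linarith))]
    rw [sub_add_cancel, Real.zero_rpow hs.ne', sub_zero]
  · refine (ae_restrict_iff' measurableSet_Ioc).2 (ae_of_all _ fun y hy => ?_)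
    have : 0 < y := hy.1
    simp only [Pi.zero_apply]; positivity

lemma lint_outside {s T u : ℝ} (hs1 : s < 1) (hu : u ∈ Ioo 0 T) :
    ∫⁻ x in (Icc (0:ℝ) T)ᶜ, ‖u - x‖ₑ ^ (s - 2) ≤
      ENNReal.ofReal (1 / (1 - s)) *
        (ENNReal.ofReal (u ^ (s - 1)) + ENNReal.ofReal ((T - u) ^ (s - 1))) := by
  have hset : (Icc (0:ℝ) T)ᶜ ⊆ Iio 0 ∪ Ioi T := by
    intro x hx
    simp only [mem_compl_iff, mem_Icc, not_and_or, not_le] at hx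
    exact hx
  refine (lintegral_mono_set hset).trans ((lintegral_union_le _ _ _).trans ?_)
  have hval : ∀ c : ℝ, 0 < c → ENNReal.ofReal (-c ^ (s - 2 + 1) / (s - 2 + 1)) =
      ENNReal.ofReal (1 / (1 - s)) * ENNReal.ofReal (c ^ (s - 1)) := by
    intro c hc
    rw [← ENNReal.ofReal_mul (by apply div_nonneg <;> linarith)]
    congr 1
    rw [show s - 2 + 1 = s - 1 by ring]
    have h1 : 1 - s ≠ 0 := by linarith
    have h2 : s - 1 ≠ 0 := by linarith
    field_simp
    ring
  have e1 : ∫⁻ x in Iio (0:ℝ), ‖u - x‖ₑ ^ (s - 2) = ∫⁻ y in Ioi u, ‖y‖ₑ ^ (s - 2) := by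
    have hmp : MeasurePreserving (fun x : ℝ => u - x) := Measure.measurePreserving_sub_left volume u
    have := hmp.setLIntegral_comp_preimage (s := Ioi u) measurableSet_Ioi
      (f := fun y => ‖y‖ₑ ^ (s - 2)) (by fun_prop)
    rw [← this]
    congr 2
    ext x; simp
  have e2 : ∫⁻ x in Ioi T, ‖u - x‖ₑ ^ (s - 2) = ∫⁻ y in Ioi (T - u), ‖y‖ₑ ^ (s - 2) := by
    have hmp : MeasurePreserving (fun x : ℝ => x - u) := measurePreserving_sub_right volume u
    have := hmp.setLIntegral_comp_preimage (s := Ioi (T - u)) measurableSet_Ioi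
      (f := fun y => ‖y‖ₑ ^ (s - 2)) (by fun_prop)
    rw [← this]
    have hs : (fun x : ℝ => x - u) ⁻¹' (Ioi (T - u)) = Ioi T := by ext x; simp
    rw [hs]
    refine lintegral_congr fun x => ?_
    rw [← enorm_neg, neg_sub]
  rw [e1, e2, lint_Ioi_rpow (by linarith) hu.1, lint_Ioi_rpow (by linarith) (sub_pos.2 hu.2),
    hval _ hu.1, hval _ (sub_pos.2 hu.2), mul_add]

lemma lint_boundary {s : ℝ} (hs : 0 < s) (hs1 : s < 1) :
    ∃ K : ℝ≥0∞, K ≠ ⊤ ∧ ∀ T : ℝ, 0 < T →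
      ∫⁻ u in Icc (0:ℝ) T, ∫⁻ x in (Icc (0:ℝ) T)ᶜ, ‖u - x‖ₑ ^ (s - 2) ≤
        K * ENNReal.ofReal (T ^ s) := by
  refine ⟨ENNReal.ofReal (1 / (1 - s)) * (2 * ENNReal.ofReal (1 / s)),
    ENNReal.mul_ne_top ENNReal.ofReal_ne_top (ENNReal.mul_ne_top (by simp) ENNReal.ofReal_ne_top),
    fun T hT => ?_⟩
  rw [← restrict_Ioo_eq_restrict_Icc]
  refine (setLIntegral_mono (g := fun u => ENNReal.ofReal (1 / (1 - s)) *
        (ENNReal.ofReal (u ^ (s - 1)) + ENNReal.ofReal ((T - u) ^ (s - 1)))) (by fun_prop)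
        (fun u hu => ?_)).trans ?_
  · exact lint_outside hs1 hu
  · rw [lintegral_const_mul _ (by fun_prop), lintegral_add_left (by fun_prop),
      lint_Ioo_rpow hs hT]
    have e2 : ∫⁻ u in Ioo 0 T, ENNReal.ofReal ((T - u) ^ (s - 1)) =
        ∫⁻ u in Ioo 0 T, ENNReal.ofReal (u ^ (s - 1)) := by
      have hmp : MeasurePreserving (fun x : ℝ => T - x) := Measure.measurePreserving_sub_left volume T
      have := hmp.setLIntegral_comp_preimage (s := Ioo 0 T) measurableSet_Ioo
        (f := fun y => ENNReal.ofReal (y ^ (s - 1))) (by fun_prop)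
      rw [← this]
      congr 2
      ext x; simp [and_comm]
    rw [e2, lint_Ioo_rpow hs hT]
    apply le_of_eq
    rw [div_eq_mul_one_div (T ^ s) s, ENNReal.ofReal_mul (by positivity : 0 ≤ T ^ s)]
    ring

/-! ### The class of functions -/

/-- Functions with a power singularity of order `s` at the origin. -/
def Cls (s : ℝ) (f : ℝ → ℝ) : Prop :=
  (∀ x ≠ 0, DifferentiableAt ℝ f x) ∧ ∃ C δ : ℝ, 0 < C ∧ 1 < δ ∧ ∀ x ≠ 0,
    |f x| ≤ C * |x| ^ (-s) ∧ |deriv f x| ≤ C * |x| ^ (-s - 1) ∧ |f x| ≤ C * |x| ^ (-δ)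

lemma ae_ne (c : ℝ) : ∀ᵐ y : ℝ, y ≠ c := by simp [ae_iff, measure_singleton]

lemma Cls.aesm {s : ℝ} {f : ℝ → ℝ} (hf : Cls s f) : AEStronglyMeasurable f := by
  have hc : ContinuousOn f {0}ᶜ := fun x hx => (hf.1 x hx).continuousAt.continuousWithinAt
  have := hc.aestronglyMeasurable (μ := volume) (measurableSet_singleton (0:ℝ)).compl
  rwa [Measure.restrict_eq_self_of_ae_mem (s := {0}ᶜ) (ae_ne 0)] at this

lemma integrable_of_min {E : Type*} [NormedAddCommGroup E] {f : ℝ → E}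
    (hm : AEStronglyMeasurable f) {C p q : ℝ}
    (hp : -1 < p) (hq : q < -1) (hb : ∀ x ≠ 0, ‖f x‖ ≤ C * min (|x| ^ p) (|x| ^ q)) :
    Integrable f := by
  refine ⟨hm, ?_⟩
  have : ∫⁻ x, ‖f x‖ₑ ≤ ∫⁻ x : ℝ, ENNReal.ofReal C * min (‖x‖ₑ ^ p) (‖x‖ₑ ^ q) := by
    refine lintegral_mono_ae ?_
    filter_upwards [ae_ne 0] with x hx
    rw [enorm_rpow_eq hx, enorm_rpow_eq hx, ← ENNReal.ofReal_min, ← ENNReal.ofReal_mul',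
      ← ofReal_norm]
    · exact ENNReal.ofReal_le_ofReal (hb x hx)
    · positivity
  refine this.trans_lt ?_
  rw [lintegral_const_mul _ (by fun_prop)]
  exact ENNReal.mul_lt_top (by simp) (lint_min hp hq)

lemma Cls.integrable {s : ℝ} {f : ℝ → ℝ} (hs : s < 1) (hf : Cls s f) : Integrable f := by
  obtain ⟨C, δ, hC, hδ, h⟩ := hf.2
  refine integrable_of_min hf.aesm (C := C) (p := -s) (q := -δ) (by linarith) (by linarith) ?_
  intro x hx
  rw [mul_min_of_nonneg _ _ hC.le]
  exact le_min (h x hx).1 (h x hx).2.2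

lemma Cls.comp_neg {s : ℝ} {f : ℝ → ℝ} (hf : Cls s f) : Cls s (fun x => f (-x)) := by
  obtain ⟨hd, C, δ, hC, hδ, h⟩ := hf
  refine ⟨fun x hx => ?_, C, δ, hC, hδ, fun x hx => ?_⟩
  · exact (differentiableAt_comp_neg).2 (hd (-x) (neg_ne_zero.2 hx))
  · have := h (-x) (neg_ne_zero.2 hx)
    rw [deriv_comp_neg, abs_neg]
    rwa [abs_neg] at this

lemma Cls.const_mul {s : ℝ} {f : ℝ → ℝ} (hf : Cls s f) {c : ℝ} (hc : 0 < c) :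
    Cls s (fun x => c * f x) := by
  obtain ⟨hd, C, δ, hC, hδ, h⟩ := hf
  refine ⟨fun x hx => (hd x hx).const_mul c, c * C, δ, by positivity, hδ, fun x hx => ?_⟩
  obtain ⟨h1, h2, h3⟩ := h x hx
  rw [deriv_const_mul _ (hd x hx), abs_mul, abs_mul, abs_of_pos hc]
  simp only [mul_assoc]
  exact ⟨by gcongr, by gcongr, by gcongr⟩

lemma Cls.mul {s s' : ℝ} {f g : ℝ → ℝ} (hf : Cls s f) (hg : Cls s' g) (hs' : 0 < s')
    (hss : s + s' < 1) : Cls (s + s') (fun x => f x * g x) := by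
  obtain ⟨hd, C, δ, hC, hδ, h⟩ := hf
  obtain ⟨hd', C', δ', hC', hδ', h'⟩ := hg
  refine ⟨fun x hx => (hd x hx).mul (hd' x hx), 2 * (C * C'), δ, by positivity, hδ,
    fun x hx => ?_⟩
  obtain ⟨h1, h2, h3⟩ := h x hx
  obtain ⟨h1', h2', h3'⟩ := h' x hx
  have hCC : C * C' ≤ 2 * (C * C') := by linarith [mul_pos hC hC']
  have hx0 : 0 < |x| := abs_pos.2 hx
  have k1 : |f x * g x| ≤ C * C' * |x| ^ (-(s + s')) := by
    rw [abs_mul, show -(s + s') = -s + -s' by ring, Real.rpow_add hx0]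
    calc |f x| * |g x| ≤ (C * |x| ^ (-s)) * (C' * |x| ^ (-s')) := by gcongr
      _ = _ := by ring
  refine ⟨k1.trans ?_, ?_, ?_⟩
  · gcongr ?_ * _
  · have : deriv (fun x => f x * g x) x = deriv f x * g x + f x * deriv g x :=
      deriv_fun_mul (hd x hx) (hd' x hx)
    rw [this]
    refine (abs_add_le _ _).trans ?_
    rw [abs_mul, abs_mul]
    calc |deriv f x| * |g x| + |f x| * |deriv g x|
        ≤ (C * |x| ^ (-s - 1)) * (C' * |x| ^ (-s')) + (C * |x| ^ (-s)) * (C' * |x| ^ (-s' - 1)) := by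
          gcongr
      _ = C * C' * (|x| ^ (-s - 1) * |x| ^ (-s')) + C * C' * (|x| ^ (-s) * |x| ^ (-s' - 1)) := by ring
      _ = _ := by
          rw [← Real.rpow_add hx0, ← Real.rpow_add hx0,
            show -s - 1 + -s' = -(s + s') - 1 by ring, show -s + (-s' - 1) = -(s + s') - 1 by ring]
          ring
  · rcases le_total |x| 1 with hx1 | hx1
    · refine k1.trans ?_
      have : |x| ^ (-(s + s')) ≤ |x| ^ (-δ) :=
        Real.rpow_le_rpow_of_exponent_ge hx0 hx1 (by linarith)
      exact mul_le_mul hCC this (by positivity) (by positivity)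
    · have k2 : |g x| ≤ C' := by
        refine h1'.trans ?_
        have : |x| ^ (-s') ≤ 1 := Real.rpow_le_one_of_one_le_of_nonpos hx1 (by linarith)
        nlinarith
      rw [abs_mul]
      calc |f x| * |g x| ≤ (C * |x| ^ (-δ)) * C' := by gcongr
        _ = C * C' * |x| ^ (-δ) := by ring
        _ ≤ _ := by gcongr ?_ * _

/-- The integral over the half line decays. -/
lemma half_decay {s : ℝ} (hs : 0 < s) (hs1 : s < 1) {f : ℝ → ℝ} (hf : Cls s f) :
    ∃ K : ℝ, 0 ≤ K ∧ ∀ t : ℝ, t ≠ 0 →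
      ‖∫ x in Ioi (0:ℝ), Complex.exp (Complex.I * x * t) * (f x)‖ ≤ K * |t| ^ (s - 1) := by
  have hInteg := hf.integrable hs1
  have haesm := hf.aesm
  obtain ⟨hd, C, δ, hC, hδ, h⟩ := hf
  refine ⟨C / (1 - s) + C + C / s, by have : 0 < 1 - s := by linarith
                                      positivity, fun t ht => ?_⟩
  have ht0 : 0 < |t| := abs_pos.2 ht
  set r : ℝ := |t|⁻¹ with hr
  have hr0 : 0 < r := by positivity
  have hnorm : ∀ x : ℝ, ‖Complex.exp (Complex.I * x * t)‖ = 1 := by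
    intro x
    rw [show Complex.I * x * t = ((x * t : ℝ) : ℂ) * Complex.I by push_cast; ring]
    exact Complex.norm_exp_ofReal_mul_I _
  have hmain : Integrable (fun x : ℝ => Complex.exp (Complex.I * x * t) * (f x)) := by
    refine (hInteg.ofReal (𝕜 := ℂ)).bdd_mul (c := 1) (by fun_prop) ?_
    exact ae_of_all _ fun x => (hnorm x).le
  rw [← Ioc_union_Ioi_eq_Ioi hr0.le, setIntegral_union (by
    rw [Set.disjoint_left]; intro x hx hx'; exact absurd hx.2 (not_le.2 hx')) measurableSet_Ioi
    hmain.integrableOn hmain.integrableOn]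
  have hrs : r ^ (1 - s) = |t| ^ (s - 1) := by
    rw [hr, Real.inv_rpow ht0.le, ← Real.rpow_neg ht0.le]; congr 1; ring
  have hrs2 : r ^ (-s) / |t| = |t| ^ (s - 1) := by
    rw [hr, Real.inv_rpow ht0.le, ← Real.rpow_neg ht0.le, Real.rpow_sub_one ht0.ne', neg_neg]
  -- first part
  have p1 : ‖∫ x in Ioc 0 r, Complex.exp (Complex.I * x * t) * (f x)‖ ≤
      C / (1 - s) * |t| ^ (s - 1) := by
    have hi : IntegrableOn (fun x : ℝ => C * x ^ (-s)) (Ioc 0 r) := by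
      have := (intervalIntegral.intervalIntegrable_rpow' (a := 0) (b := r) (r := -s) (by linarith))
      rw [intervalIntegrable_iff_integrableOn_Ioc_of_le hr0.le] at this
      exact this.const_mul C
    have := norm_integral_le_of_norm_le (μ := volume.restrict (Ioc 0 r))
      (f := fun x : ℝ => Complex.exp (Complex.I * x * t) * (f x)) hi
      ((ae_restrict_iff' measurableSet_Ioc).2 (ae_of_all _ fun x hx => by
        rw [norm_mul, hnorm, one_mul, Complex.norm_real, Real.norm_eq_abs]
        have := (h x hx.1.ne').1
        rwa [abs_of_pos hx.1] at this))
    refine this.trans (le_of_eq ?_)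
    rw [integral_const_mul, ← intervalIntegral.integral_of_le hr0.le,
      integral_rpow (Or.inl (by linarith)), Real.zero_rpow (by linarith), sub_zero,
      show -s + 1 = 1 - s by ring, hrs]
    ring
  -- second part
  have hIt : Complex.I * (t : ℂ) ≠ 0 := mul_ne_zero Complex.I_ne_zero (by exact_mod_cast ht)
  set v : ℝ → ℂ := fun x => Complex.exp (Complex.I * x * t) / (Complex.I * t) with hv
  have hvn : ∀ x, ‖v x‖ = |t|⁻¹ := by
    intro x
    simp only [hv]
    rw [norm_div, hnorm, norm_mul, Complex.norm_I, one_mul, Complex.norm_real, Real.norm_eq_abs,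
      one_div]
  have hvd : ∀ x : ℝ, HasDerivAt v (Complex.exp (Complex.I * x * t)) x := by
    intro x
    have h1 : HasDerivAt (fun z : ℂ => Complex.exp (Complex.I * z * t) / (Complex.I * t))
        (Complex.exp (Complex.I * x * t)) (x : ℂ) := by
      have h2 : HasDerivAt (fun z : ℂ => Complex.I * z * t) (Complex.I * 1 * t) (x : ℂ) :=
        ((hasDerivAt_id (x : ℂ)).const_mul Complex.I).mul_const (t : ℂ)
      have h3 := (h2.cexp).div_const (Complex.I * t)
      rw [mul_one, mul_div_assoc, div_self hIt, mul_one] at h3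
      exact h3
    exact h1.comp_ofReal
  have hvc : Continuous v := by simp only [hv]; fun_prop
  have hu : ∀ x ∈ Ioi r, HasDerivAt (fun y : ℝ => (f y : ℂ)) ((deriv f x : ℝ) : ℂ) x := by
    intro x hx
    have hx0 : x ≠ 0 := (hr0.trans hx).ne'
    exact (hd x hx0).hasDerivAt.ofReal_comp
  have hder_b : ∀ x ∈ Ioi r, ‖((deriv f x : ℝ) : ℂ) * v x‖ ≤ C * |t|⁻¹ * x ^ (-s - 1) := by
    intro x hx
    have hx0 : 0 < x := hr0.trans hx
    have := (h x hx0.ne').2.1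
    rw [abs_of_pos hx0] at this
    rw [norm_mul, hvn, Complex.norm_real, Real.norm_eq_abs]
    calc |deriv f x| * |t|⁻¹ ≤ (C * x ^ (-s - 1)) * |t|⁻¹ := by gcongr
      _ = _ := by ring
  have hbi : IntegrableOn (fun x : ℝ => C * |t|⁻¹ * x ^ (-s - 1)) (Ioi r) :=
    (integrableOn_Ioi_rpow_of_lt (by linarith) hr0).const_mul _
  have hu'v : IntegrableOn ((fun x : ℝ => ((deriv f x : ℝ) : ℂ)) * v) (Ioi r) := by
    refine Integrable.mono' hbi ?_ ((ae_restrict_iff' measurableSet_Ioi).2 (ae_of_all _ hder_b))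
    have hm : Measurable (fun x : ℝ => ((deriv f x : ℝ) : ℂ) * v x) :=
      (Complex.measurable_ofReal.comp (measurable_deriv f)).mul hvc.measurable
    exact hm.aestronglyMeasurable
  have huv' : IntegrableOn ((fun x : ℝ => (f x : ℂ)) *
      (fun x : ℝ => Complex.exp (Complex.I * x * t))) (Ioi r) := by
    have := hmain.integrableOn (s := Ioi r)
    refine this.congr (ae_of_all _ fun x => ?_)
    simp only [Pi.mul_apply]; ring
  have hzero : Tendsto ((fun x : ℝ => (f x : ℂ)) * v) (𝓝[>] r) (𝓝 ((f r : ℂ) * v r)) := by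
    have : ContinuousAt (fun x : ℝ => (f x : ℂ) * v x) r :=
      (Complex.continuous_ofReal.continuousAt.comp (hd r hr0.ne').continuousAt).mul hvc.continuousAt
    exact this.tendsto.mono_left nhdsWithin_le_nhds
  have hinf : Tendsto ((fun x : ℝ => (f x : ℂ)) * v) atTop (𝓝 0) := by
    have hlim : Tendsto (fun x : ℝ => C * |t|⁻¹ * x ^ (-s)) atTop (𝓝 0) := by
      have := (tendsto_rpow_neg_atTop hs).const_mul (C * |t|⁻¹)
      rwa [mul_zero] at this
    refine squeeze_zero_norm' ?_ hlim
    filter_upwards [eventually_gt_atTop 0] with x hx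
    have := (h x hx.ne').1
    rw [abs_of_pos hx] at this
    rw [Pi.mul_apply, norm_mul, hvn, Complex.norm_real, Real.norm_eq_abs]
    calc |f x| * |t|⁻¹ ≤ (C * x ^ (-s)) * |t|⁻¹ := by gcongr
      _ = _ := by ring
  have ibp := integral_Ioi_mul_deriv_eq_deriv_mul hu (fun x _ => hvd x) huv' hu'v hzero hinf
  have p2 : ‖∫ x in Ioi r, Complex.exp (Complex.I * x * t) * (f x)‖ ≤
      C * |t| ^ (s - 1) + C / s * |t| ^ (s - 1) := by
    have e : ∫ x in Ioi r, Complex.exp (Complex.I * x * t) * (f x) =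
        ∫ x in Ioi r, (f x : ℂ) * Complex.exp (Complex.I * x * t) := by
      congr 1; ext x; ring
    rw [e, ibp, zero_sub]
    have hA : ‖(f r : ℂ) * v r‖ ≤ C * |t| ^ (s - 1) := by
      have := (h r hr0.ne').1
      rw [abs_of_pos hr0] at this
      rw [norm_mul, hvn, Complex.norm_real, Real.norm_eq_abs, ← hrs2]
      calc |f r| * |t|⁻¹ ≤ (C * r ^ (-s)) * |t|⁻¹ := by gcongr
        _ = _ := by ring
    have hB : ‖∫ x in Ioi r, ((deriv f x : ℝ) : ℂ) * v x‖ ≤ C / s * |t| ^ (s - 1) := by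
      refine (norm_integral_le_of_norm_le hbi
        ((ae_restrict_iff' measurableSet_Ioi).2 (ae_of_all _ hder_b))).trans (le_of_eq ?_)
      rw [integral_const_mul, integral_Ioi_rpow_of_lt (by linarith) hr0, ← hrs2,
        show -s - 1 + 1 = -s by ring]
      field_simp
    calc _ ≤ ‖-((f r : ℂ) * v r)‖ + ‖∫ x in Ioi r, ((deriv f x : ℝ) : ℂ) * v x‖ := norm_sub_le _ _
      _ ≤ _ := by rw [norm_neg]; exact add_le_add hA hB
  calc _ ≤ _ := norm_add_le _ _
    _ ≤ _ := add_le_add p1 p2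
    _ = _ := by ring
/-! ### The Fourier transform -/

lemma norm_expI (x t : ℝ) : ‖Complex.exp (Complex.I * x * t)‖ = 1 := by
  rw [show Complex.I * x * t = ((x * t : ℝ) : ℂ) * Complex.I by push_cast; ring]
  exact Complex.norm_exp_ofReal_mul_I _

lemma integrable_expI {f : ℝ → ℝ} (hf : Integrable f) (t : ℝ) :
    Integrable (fun x : ℝ => Complex.exp (Complex.I * x * t) * (f x)) := by
  refine (hf.ofReal (𝕜 := ℂ)).bdd_mul (c := 1) (by fun_prop) ?_
  exact ae_of_all _ fun x => (norm_expI x t).le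

lemma hatR_continuous {f : ℝ → ℝ} (hf : Integrable f) : Continuous (hatR f) := by
  refine continuous_of_dominated (bound := fun x => ‖f x‖)
    (fun t => (integrable_expI hf t).aestronglyMeasurable) ?_ hf.norm ?_
  · intro t
    exact ae_of_all _ fun x => by rw [norm_mul, norm_expI, one_mul, Complex.norm_real]
  · exact ae_of_all _ fun x => by fun_prop

lemma hatR_decay {s : ℝ} (hs : 0 < s) (hs1 : s < 1) {f : ℝ → ℝ} (hf : Cls s f) :
    ∃ K : ℝ, 0 < K ∧ ∀ t : ℝ, ‖hatR f t‖ ≤ K ∧ (t ≠ 0 → ‖hatR f t‖ ≤ K * |t| ^ (s - 1)) := by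
  have hInteg := hf.integrable hs1
  obtain ⟨K₁, hK₁, h₁⟩ := half_decay hs hs1 hf
  obtain ⟨K₂, hK₂, h₂⟩ := half_decay hs hs1 hf.comp_neg
  have hI : 0 ≤ ∫ x, ‖f x‖ := integral_nonneg fun x => norm_nonneg _
  refine ⟨K₁ + K₂ + (∫ x, ‖f x‖) + 1, by positivity, fun t => ⟨?_, fun ht => ?_⟩⟩
  · have : ‖hatR f t‖ ≤ ∫ x, ‖f x‖ := by
      refine (norm_integral_le_integral_norm _).trans (le_of_eq ?_)
      congr 1; ext x; rw [norm_mul, norm_expI, one_mul, Complex.norm_real]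
    linarith
  · have e : hatR f t = (∫ x in Ioi (0:ℝ), Complex.exp (Complex.I * x * ((-t : ℝ) : ℂ)) * (f (-x) : ℝ))
        + ∫ x in Ioi (0:ℝ), Complex.exp (Complex.I * x * t) * (f x) := by
      have := integral_comp_neg_Ioi (0:ℝ) (fun x : ℝ => Complex.exp (Complex.I * x * t) * (f x))
      rw [neg_zero] at this
      have h3 : ∫ x in Ioi (0:ℝ), Complex.exp (Complex.I * x * ((-t : ℝ) : ℂ)) * (f (-x) : ℝ) =
          ∫ x in Iic (0:ℝ), Complex.exp (Complex.I * x * t) * (f x) := by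
        rw [← this]
        congr 1; ext x; push_cast; congr 2; ring
      rw [h3]
      exact (intervalIntegral.integral_Iic_add_Ioi (integrable_expI hInteg t).integrableOn
        (integrable_expI hInteg t).integrableOn).symm
    rw [e]
    have a1 := h₁ t ht
    have a2 := h₂ (-t) (neg_ne_zero.2 ht)
    rw [abs_neg] at a2
    have hp : 0 ≤ |t| ^ (s - 1) := by positivity
    refine (norm_add_le _ _).trans ((add_le_add a2 a1).trans ?_)
    nlinarith

lemma hat_prod_integrable {a b : ℝ} (ha : 0 < a) (hb : 0 < b) (hab : a + b < 1) {f g : ℝ → ℝ}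
    (hf : Cls a f) (hg : Cls b g) (d : ℝ) :
    Integrable (fun y => hatR f (d - y) * hatR g y) := by
  obtain ⟨K, hK, h⟩ := hatR_decay ha (by linarith) hf
  obtain ⟨K', hK', h'⟩ := hatR_decay hb (by linarith) hg
  have hfc := hatR_continuous (hf.integrable (by linarith))
  have hgc := hatR_continuous (hg.integrable (by linarith))
  set m : ℝ → ℝ := fun t => min (|t| ^ (0:ℝ)) (|t| ^ (a + b - 2)) with hm
  have hmi : Integrable m := by
    refine integrable_of_min (C := 1) (p := 0) (q := a + b - 2) ?_ (by norm_num) (by linarith) ?_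
    · have : Measurable m := by simp only [hm]; fun_prop
      exact this.aestronglyMeasurable
    · intro x hx
      have : 0 ≤ m x := by simp only [hm]; positivity
      rw [one_mul, Real.norm_of_nonneg this]
  have hm0 : ∀ x, 0 ≤ m x := fun x => by simp only [hm]; positivity
  have key : ∀ a b : ℝ, 0 < a → 0 < b → ∀ K K' : ℝ, 0 < K → 0 < K' → ∀ A B x y : ℝ, 0 ≤ A → 0 ≤ B →
      A ≤ K → A ≤ K * |x| ^ (a - 1) → B ≤ K' → (y ≠ 0 → B ≤ K' * |y| ^ (b - 1)) → x ≠ 0 → b < 1 →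
      |x| ≤ |y| → A * B ≤ K * K' * min (|x| ^ (0:ℝ)) (|x| ^ (a + b - 2)) := by
    intro a b ha hb K K' hK hK' A B x y hA hB h1 h2 h3 h4 hx hb1 hxy
    have hx0 : 0 < |x| := abs_pos.2 hx
    have hy0 : y ≠ 0 := abs_pos.1 (hx0.trans_le hxy)
    rw [mul_min_of_nonneg _ _ (by positivity)]
    refine le_min ?_ ?_
    · rw [Real.rpow_zero, mul_one]; gcongr
    · have h5 : |y| ^ (b - 1) ≤ |x| ^ (b - 1) :=
        Real.rpow_le_rpow_of_nonpos hx0 hxy (by linarith)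
      have h6 : B ≤ K' * |x| ^ (b - 1) := (h4 hy0).trans (by gcongr)
      calc A * B ≤ (K * |x| ^ (a - 1)) * (K' * |x| ^ (b - 1)) := by gcongr
        _ = K * K' * (|x| ^ (a - 1) * |x| ^ (b - 1)) := by ring
        _ = _ := by rw [← Real.rpow_add hx0]; congr 2; ring
  have hdom : Integrable (fun y => K * K' * (m (d - y) + m y)) :=
    ((hmi.comp_sub_left d).add hmi).const_mul _
  refine hdom.mono' (by fun_prop) ?_
  filter_upwards [ae_ne 0, ae_ne d] with y hy hyd
  have hyd' : d - y ≠ 0 := by intro hh; apply hyd; linarith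
  rw [norm_mul]
  have hKK : 0 < K * K' := mul_pos hK hK'
  rcases le_total |d - y| |y| with hle | hle
  · have := key a b ha hb K K' hK hK' _ _ (d - y) y (norm_nonneg _) (norm_nonneg _)
      (h (d - y)).1 ((h (d - y)).2 hyd') (h' y).1 (h' y).2 hyd' (by linarith) hle
    refine this.trans ?_
    gcongr
    exact le_add_of_nonneg_right (hm0 _)
  · have := key b a hb ha K' K hK' hK _ _ y (d - y) (norm_nonneg _) (norm_nonneg _)
      (h' y).1 ((h' y).2 hy) (h (d - y)).1 (h (d - y)).2 hy (by linarith) hle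
    rw [mul_comm, mul_comm K K']
    refine this.trans ?_
    rw [add_comm b a]
    gcongr
    exact le_add_of_nonneg_left (hm0 _)

lemma conv_continuousAt {F G : ℝ → ℂ} {a b δ C C' : ℝ} (ha : 0 < a) (hb : 0 < b) (hab : a + b < 1)
    (hδ : 1 < δ) (hC : 0 < C) (hC' : 0 < C')
    (hFi : Integrable F) (hGi : Integrable G)
    (hFc : ∀ x ≠ 0, ContinuousAt F x) (hGc : ∀ x ≠ 0, ContinuousAt G x)
    (hF : ∀ x ≠ 0, ‖F x‖ ≤ C * |x| ^ (-a))
    (hG : ∀ x ≠ 0, ‖G x‖ ≤ C' * |x| ^ (-b)) (hG' : ∀ x ≠ 0, ‖G x‖ ≤ C' * |x| ^ (-δ)) :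
    Tendsto (fun x => ∫ t, F t * G (x - t)) (𝓝 0) (𝓝 (∫ t, F t * G (-t))) := by
  set D : ℝ → ℝ := fun t => C * C' * min (|t| ^ (-a - b)) (|t| ^ (-a - δ)) with hD
  have hD0 : ∀ x, 0 ≤ D x := fun x => by simp only [hD]; positivity
  have hDi : Integrable D := by
    refine integrable_of_min (C := C * C') (p := -a - b) (q := -a - δ) ?_ (by linarith) (by linarith) ?_
    · have : Measurable D := by simp only [hD]; fun_prop
      exact this.aestronglyMeasurable
    · intro x hx
      rw [Real.norm_of_nonneg (hD0 x)]
  have key : ∀ t y z : ℝ, t ≠ 0 → |t| ≤ |y| → |t| ≤ |z| → ‖F y * G z‖ ≤ D t := by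
    intro t y z ht hy hz
    have ht0 : 0 < |t| := abs_pos.2 ht
    have hy0 : y ≠ 0 := abs_pos.1 (ht0.trans_le hy)
    have hz0 : z ≠ 0 := abs_pos.1 (ht0.trans_le hz)
    have h1 : ‖F y‖ ≤ C * |t| ^ (-a) := (hF y hy0).trans
      (mul_le_mul_of_nonneg_left (Real.rpow_le_rpow_of_nonpos ht0 hy (by linarith)) hC.le)
    have h2 : ‖G z‖ ≤ C' * |t| ^ (-b) := (hG z hz0).trans
      (mul_le_mul_of_nonneg_left (Real.rpow_le_rpow_of_nonpos ht0 hz (by linarith)) hC'.le)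
    have h3 : ‖G z‖ ≤ C' * |t| ^ (-δ) := (hG' z hz0).trans
      (mul_le_mul_of_nonneg_left (Real.rpow_le_rpow_of_nonpos ht0 hz (by linarith)) hC'.le)
    rw [norm_mul]
    simp only [hD]
    rw [mul_min_of_nonneg _ _ (by positivity)]
    refine le_min ?_ ?_
    · calc ‖F y‖ * ‖G z‖ ≤ (C * |t| ^ (-a)) * (C' * |t| ^ (-b)) := by gcongr
        _ = C * C' * (|t| ^ (-a) * |t| ^ (-b)) := by ring
        _ = _ := by rw [← Real.rpow_add ht0]; congr 2
    · calc ‖F y‖ * ‖G z‖ ≤ (C * |t| ^ (-a)) * (C' * |t| ^ (-δ)) := by gcongr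
        _ = C * C' * (|t| ^ (-a) * |t| ^ (-δ)) := by ring
        _ = _ := by rw [← Real.rpow_add ht0]; congr 2
  set H₁ : ℝ → ℝ → ℂ := fun x => indicator {t | |t| ≤ |x - t|} (fun t => F t * G (x - t)) with hH₁
  set H₂ : ℝ → ℝ → ℂ := fun x => indicator {t | |t| < |t + x|} (fun t => F (t + x) * G (-t)) with hH₂
  have m₁ : ∀ x, MeasurableSet {t : ℝ | |t| ≤ |x - t|} := fun x =>
    measurableSet_le (by fun_prop) (by fun_prop)
  have m₂ : ∀ x, MeasurableSet {t : ℝ | |t| < |t + x|} := fun x =>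
    measurableSet_lt (by fun_prop) (by fun_prop)
  have s₁ : ∀ x, AEStronglyMeasurable (H₁ x) := fun x =>
    (hFi.aestronglyMeasurable.mul (hGi.comp_sub_left x).aestronglyMeasurable).indicator (m₁ x)
  have s₂ : ∀ x, AEStronglyMeasurable (H₂ x) := fun x =>
    ((hFi.comp_add_right x).aestronglyMeasurable.mul hGi.comp_neg.aestronglyMeasurable).indicator (m₂ x)
  have d₁ : ∀ x, ∀ t ≠ 0, ‖H₁ x t‖ ≤ D t := by
    intro x t ht
    simp only [hH₁]
    by_cases hh : t ∈ {t : ℝ | |t| ≤ |x - t|}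
    · rw [indicator_of_mem hh]; exact key t t (x - t) ht le_rfl hh
    · rw [indicator_of_notMem hh, norm_zero]; exact hD0 t
  have d₂ : ∀ x, ∀ t ≠ 0, ‖H₂ x t‖ ≤ D t := by
    intro x t ht
    simp only [hH₂]
    by_cases hh : t ∈ {t : ℝ | |t| < |t + x|}
    · rw [indicator_of_mem hh]; exact key t (t + x) (-t) ht (le_of_lt hh) (by rw [abs_neg])
    · rw [indicator_of_notMem hh, norm_zero]; exact hD0 t
  have i₁ : ∀ x, Integrable (H₁ x) := fun x => hDi.mono' (s₁ x) (by
    filter_upwards [ae_ne 0] with t ht using d₁ x t ht)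
  have i₂ : ∀ x, Integrable (H₂ x) := fun x => hDi.mono' (s₂ x) (by
    filter_upwards [ae_ne 0] with t ht using d₂ x t ht)
  have split : ∀ x, ∫ t, F t * G (x - t) = ∫ t, (H₁ x t + H₂ x t) := by
    intro x
    have e1 : ∀ t, F t * G (x - t) = H₁ x t + H₂ x (t - x) := by
      intro t
      simp only [hH₁, hH₂]
      by_cases hh : |t| ≤ |x - t|
      · rw [indicator_of_mem (by exact hh), indicator_of_notMem, add_zero]
        simp only [mem_ofPred_eq, sub_add_cancel, not_lt]
        rwa [abs_sub_comm]
      · rw [indicator_of_notMem (by exact hh), indicator_of_mem, zero_add, sub_add_cancel, neg_sub]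
        simp only [mem_ofPred_eq, sub_add_cancel]
        rw [abs_sub_comm]; exact not_le.1 hh
    simp_rw [e1]
    rw [integral_add (i₁ x) ((i₂ x).comp_sub_right x), integral_add (i₁ x) (i₂ x),
      integral_sub_right_eq_self (H₂ x) x]
  simp_rw [split]
  refine tendsto_integral_filter_of_dominated_convergence (fun t => D t + D t)
    (Eventually.of_forall fun x => (s₁ x).add (s₂ x)) ?_ (hDi.add hDi) ?_
  · refine Eventually.of_forall fun x => ?_
    filter_upwards [ae_ne 0] with t ht
    exact (norm_add_le _ _).trans (add_le_add (d₁ x t ht) (d₂ x t ht))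
  · filter_upwards [ae_ne 0] with t ht
    have ht0 : 0 < |t| := abs_pos.2 ht
    have l1 : Tendsto (fun x => F t * G (x - t)) (𝓝 0) (𝓝 (F t * G (-t))) := by
      refine Tendsto.const_mul _ ?_
      have h1 : Tendsto (fun x : ℝ => x - t) (𝓝 0) (𝓝 (-t)) := by
        have : Continuous (fun x : ℝ => x - t) := by fun_prop
        simpa using this.tendsto 0
      exact (hGc (-t) (neg_ne_zero.2 ht)).tendsto.comp h1
    have l2 : Tendsto (fun x => F (t + x) * G (-t)) (𝓝 0) (𝓝 (F t * G (-t))) := by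
      refine Tendsto.mul_const _ ?_
      have h1 : Tendsto (fun x : ℝ => t + x) (𝓝 0) (𝓝 t) := by
        have : Continuous (fun x : ℝ => t + x) := by fun_prop
        simpa using this.tendsto 0
      exact (hFc t ht).tendsto.comp h1
    rw [tendsto_iff_norm_sub_tendsto_zero] at l1 l2 ⊢
    have l3 := l1.add l2
    rw [add_zero] at l3
    refine squeeze_zero' (Eventually.of_forall fun x => norm_nonneg _) ?_ l3
    have hev : ∀ᶠ x in 𝓝 (0:ℝ), |x| < |t| := by
      have : Tendsto (fun x : ℝ => |x|) (𝓝 0) (𝓝 0) := by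
        simpa using (continuous_abs.tendsto (0:ℝ))
      exact this.eventually_lt_const ht0
    filter_upwards [hev] with x hx
    simp only [hH₁, hH₂]
    by_cases h1 : |t| ≤ |x - t|
    · have h2 : ¬ (|t| < |t + x|) := by
        rcases lt_or_gt_of_ne ht with h0 | h0
        · rw [abs_of_neg h0] at hx h1 ⊢
          rw [abs_lt] at hx
          rw [abs_of_pos (by linarith)] at h1
          rw [abs_of_neg (by linarith)]; linarith
        · rw [abs_of_pos h0] at hx h1 ⊢
          rw [abs_lt] at hx
          rw [abs_of_neg (by linarith)] at h1
          rw [abs_of_pos (by linarith)]; linarith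
      rw [indicator_of_mem (by exact h1), indicator_of_notMem (by exact h2), add_zero]
      exact le_add_of_nonneg_right (norm_nonneg _)
    · have h2 : |t| < |t + x| := by
        rcases lt_or_gt_of_ne ht with h0 | h0
        · rw [abs_of_neg h0] at hx h1 ⊢
          rw [abs_lt] at hx
          rw [abs_of_pos (by linarith)] at h1
          rw [abs_of_neg (by linarith)]; linarith
        · rw [abs_of_pos h0] at hx h1 ⊢
          rw [abs_lt] at hx
          rw [abs_of_neg (by linarith)] at h1
          rw [abs_of_pos (by linarith)]; linarith
      rw [indicator_of_notMem (by exact h1), indicator_of_mem (by exact h2), zero_add]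
      exact le_add_of_nonneg_left (norm_nonneg _)

open scoped FourierTransform Convolution in
lemma parseval {a b : ℝ} (ha : 0 < a) (hb : 0 < b) (hab : a + b < 1) {f g : ℝ → ℝ}
    (hf : Cls a f) (hg : Cls b g) (d : ℝ) :
    ∫ y, hatR f (d - y) * hatR g y = hatR (fun x => 2 * π * (f x * g x)) d := by
  have hfi := hf.integrable (by linarith)
  have hgi := hg.integrable (by linarith)
  have hprod := hat_prod_integrable ha hb hab hf hg d
  set F : ℝ → ℂ := fun x => Complex.exp (Complex.I * x * ((-d : ℝ) : ℂ)) * (f (-x) : ℝ) with hF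
  set G : ℝ → ℂ := fun x => (g x : ℂ) with hG
  have hFi : Integrable F := integrable_expI hfi.comp_neg (-d)
  have hGi : Integrable G := hgi.ofReal
  have hFn : ∀ x, ‖F x‖ = |f (-x)| := fun x => by
    simp only [hF]; rw [norm_mul, norm_expI, one_mul, Complex.norm_real, Real.norm_eq_abs]
  have hGn : ∀ x, ‖G x‖ = |g x| := fun x => by
    simp only [hG]; rw [Complex.norm_real, Real.norm_eq_abs]
  set k : ℝ → ℂ := F ⋆[ContinuousLinearMap.mul ℂ ℂ] G with hk
  have hki : Integrable k := hFi.integrable_convolution _ hGi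
  have hkx : ∀ x, k x = ∫ t, F t * G (x - t) := fun x => rfl
  have hkc : ContinuousAt k 0 := by
    obtain ⟨hd, C, δ, hC, hδ, h⟩ := hf.comp_neg
    obtain ⟨hd', C', δ', hC', hδ', h'⟩ := hg
    have := conv_continuousAt (F := F) (G := G) ha hb hab hδ' hC hC' hFi hGi
      (fun x hx => by
        have : ContinuousAt (fun x => f (-x)) x := (hd x hx).continuousAt
        have h2 : ContinuousAt (fun x => ((f (-x) : ℝ) : ℂ)) x :=
          Complex.continuous_ofReal.continuousAt.comp this
        exact ContinuousAt.mul (by fun_prop) h2)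
      (fun x hx => Complex.continuous_ofReal.continuousAt.comp (hd' x hx).continuousAt)
      (fun x hx => by rw [hFn]; exact (h x hx).1)
      (fun x hx => by rw [hGn]; exact (h' x hx).1)
      (fun x hx => by rw [hGn]; exact (h' x hx).2.2)
    have h0 : k 0 = ∫ t, F t * G (-t) := by rw [hkx]; simp
    rw [ContinuousAt, h0]
    exact this
  have hFF : ∀ ξ : ℝ, 𝓕 F ξ = hatR f (d - (-2 * π) * ξ) := by
    intro ξ
    rw [Real.fourier_real_eq_integral_exp_smul, hatR,
      ← integral_neg_eq_self (fun x : ℝ => Complex.exp (Complex.I * x * ((d - -2 * π * ξ : ℝ) : ℂ)) * (f x))]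
    congr 1; ext x
    simp only [hF, smul_eq_mul]
    rw [← mul_assoc, ← Complex.exp_add]
    congr 2
    push_cast; ring
  have hGG : ∀ ξ : ℝ, 𝓕 G ξ = hatR g ((-2 * π) * ξ) := by
    intro ξ
    rw [Real.fourier_real_eq_integral_exp_smul, hatR]
    congr 1; ext x
    simp only [hG, smul_eq_mul]
    congr 2
    push_cast; ring
  have hkF : 𝓕 k = fun ξ : ℝ => hatR f (d - (-2 * π) * ξ) * hatR g ((-2 * π) * ξ) := by
    ext ξ
    rw [hk, Real.fourier_mul_convolution_eq hFi hGi, hFF, hGG]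
  have h2pi : (-2 * π : ℝ) ≠ 0 := by have := Real.pi_pos; linarith
  have hkFi : Integrable (𝓕 k) := by
    rw [hkF]
    exact hprod.comp_mul_left' h2pi
  have inv := hki.fourierInv_fourier_eq hkFi hkc
  rw [Real.fourierInv_eq', hkF] at inv
  simp only [inner_zero_right, mul_zero, Complex.ofReal_zero, zero_mul, Complex.exp_zero,
    one_smul] at inv
  have hsc := Measure.integral_comp_mul_left (fun y => hatR f (d - y) * hatR g y) (-2 * π)
  rw [hsc, hkx] at inv
  have habs : |(-2 * π)⁻¹| = (2 * π)⁻¹ := by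
    rw [abs_inv]; congr 1; rw [abs_mul, abs_of_pos Real.pi_pos]; norm_num
  rw [habs] at inv
  have hR : ∫ t, F t * G (0 - t) = ∫ x : ℝ, Complex.exp (Complex.I * x * d) * ((f x * g x : ℝ) : ℂ) := by
    rw [← integral_neg_eq_self (fun x : ℝ => Complex.exp (Complex.I * x * d) * ((f x * g x : ℝ) : ℂ))]
    congr 1; ext x
    simp only [hF, hG, zero_sub]
    push_cast
    rw [mul_assoc]
    congr 2
    ring
  rw [hR] at inv
  have hfin : hatR (fun x => 2 * π * (f x * g x)) d =
      ((2 * π : ℝ) : ℂ) * ∫ x : ℝ, Complex.exp (Complex.I * x * d) * ((f x * g x : ℝ) : ℂ) := by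
    rw [hatR, ← integral_const_mul]
    congr 1; ext x; push_cast; ring
  rw [hfin, ← inv, Complex.real_smul, ← mul_assoc, ← Complex.ofReal_mul, mul_inv_cancel₀ (by positivity)]
  simp
/-! ### The truncated chain -/

/-- One truncated convolution step. -/
def stepK (T : ℝ) (f : ℝ → ℝ) (G : ℝ → ℝ → ℂ) (v w : ℝ) : ℂ :=
  ∫ x in Icc (0:ℝ) T, G v x * hatR f (x - w)

lemma stepK_continuous {T : ℝ} {f : ℝ → ℝ} {G : ℝ → ℝ → ℂ} (hf : Integrable f)
    (hG : Continuous (Function.uncurry G)) : Continuous (Function.uncurry (stepK T f G)) := by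
  have hfc := hatR_continuous hf
  have h : Continuous (Function.uncurry (fun (p : ℝ × ℝ) (x : ℝ) => G p.1 x * hatR f (x - p.2))) := by
    have h1 : Continuous (fun q : (ℝ × ℝ) × ℝ => G q.1.1 q.2) :=
      hG.comp (by fun_prop : Continuous (fun q : (ℝ × ℝ) × ℝ => (q.1.1, q.2)))
    have h2 : Continuous (fun q : (ℝ × ℝ) × ℝ => hatR f (q.2 - q.1.2)) := by fun_prop
    exact h1.mul h2
  exact continuous_parametric_integral_of_continuous h isCompact_Icc

lemma hatR_enorm_decay {s : ℝ} (hs : 0 < s) (hs1 : s < 1) {f : ℝ → ℝ} (hf : Cls s f) :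
    ∃ K : ℝ≥0∞, K ≠ ⊤ ∧ ∀ t : ℝ, ‖hatR f t‖ₑ ≤ K * ‖t‖ₑ ^ (s - 1) := by
  obtain ⟨K, hK, h⟩ := hatR_decay hs hs1 hf
  refine ⟨ENNReal.ofReal K, ENNReal.ofReal_ne_top, fun t => ?_⟩
  rcases eq_or_ne t 0 with rfl | ht
  · rw [enorm_zero, ENNReal.zero_rpow_of_neg (by linarith), ENNReal.mul_top (by simpa using hK)]
    exact le_top
  · rw [enorm_rpow_eq ht, ← ENNReal.ofReal_mul hK.le, ← ofReal_norm]
    exact ENNReal.ofReal_le_ofReal ((h t).2 ht)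

lemma step_bound {a s : ℝ} (ha : 0 < a) (hs : 0 < s) (has : s + a < 1) {f g : ℝ → ℝ}
    (hf : Cls a f) (hg : Cls s g) :
    ∃ K : ℝ≥0∞, K ≠ ⊤ ∧ ∀ (T : ℝ) (G : ℝ → ℝ → ℂ), Continuous (Function.uncurry G) → ∀ v w : ℝ,
      ‖stepK T f G v w - hatR (fun x => 2 * π * (g x * f x)) (v - w)‖ₑ ≤
        K * ((∫⁻ x in Icc (0:ℝ) T, ‖G v x - hatR g (v - x)‖ₑ * ‖x - w‖ₑ ^ (a - 1)) +
          ∫⁻ x in (Icc (0:ℝ) T)ᶜ, ‖v - x‖ₑ ^ (s - 1) * ‖x - w‖ₑ ^ (a - 1)) := by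
  obtain ⟨K₁, hK₁, h₁⟩ := hatR_enorm_decay ha (by linarith) hf
  obtain ⟨K₂, hK₂, h₂⟩ := hatR_enorm_decay hs (by linarith) hg
  have hfc := hatR_continuous (hf.integrable (by linarith))
  have hgc := hatR_continuous (hg.integrable (by linarith))
  refine ⟨K₁ + K₂ * K₁, ENNReal.add_ne_top.2 ⟨hK₁, ENNReal.mul_ne_top hK₂ hK₁⟩,
    fun T G hG v w => ?_⟩
  have hi0 := hat_prod_integrable hs ha has hg hf (v - w)
  have hi : Integrable (fun x => hatR g (v - x) * hatR f (x - w)) := by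
    have := hi0.comp_sub_right w
    refine this.congr (ae_of_all _ fun x => ?_)
    simp only
    congr 2; ring
  have hpar : hatR (fun x => 2 * π * (g x * f x)) (v - w) =
      ∫ x, hatR g (v - x) * hatR f (x - w) := by
    rw [← parseval hs ha has hg hf (v - w),
      ← integral_sub_right_eq_self (fun y => hatR g (v - w - y) * hatR f y) w]
    congr 1; ext x; congr 2; ring
  have hGv : Continuous (fun x => G v x) :=
    hG.comp (by fun_prop : Continuous (fun x : ℝ => (v, x)))
  have hi1 : IntegrableOn (fun x => G v x * hatR f (x - w)) (Icc 0 T) :=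
    (by fun_prop : Continuous (fun x => G v x * hatR f (x - w))).continuousOn.integrableOn_compact
      isCompact_Icc
  have e : stepK T f G v w - hatR (fun x => 2 * π * (g x * f x)) (v - w) =
      (∫ x in Icc (0:ℝ) T, (G v x - hatR g (v - x)) * hatR f (x - w)) -
        ∫ x in (Icc (0:ℝ) T)ᶜ, hatR g (v - x) * hatR f (x - w) := by
    rw [hpar, ← integral_add_compl (measurableSet_Icc (a := (0:ℝ)) (b := T)) hi, stepK, ← sub_sub,
      ← integral_sub hi1 hi.integrableOn]
    congr 2; ext x; ring
  rw [e]
  refine (enorm_sub_le).trans ?_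
  have b1 : ‖∫ x in Icc (0:ℝ) T, (G v x - hatR g (v - x)) * hatR f (x - w)‖ₑ ≤
      K₁ * ∫⁻ x in Icc (0:ℝ) T, ‖G v x - hatR g (v - x)‖ₑ * ‖x - w‖ₑ ^ (a - 1) := by
    refine (enorm_integral_le_lintegral_enorm _).trans ?_
    rw [← lintegral_const_mul' _ _ hK₁]
    refine lintegral_mono fun x => ?_
    simp only
    rw [enorm_mul]
    calc _ ≤ ‖G v x - hatR g (v - x)‖ₑ * (K₁ * ‖x - w‖ₑ ^ (a - 1)) := by gcongr; exact h₁ _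
      _ = _ := by ring
  have b2 : ‖∫ x in (Icc (0:ℝ) T)ᶜ, hatR g (v - x) * hatR f (x - w)‖ₑ ≤
      K₂ * K₁ * ∫⁻ x in (Icc (0:ℝ) T)ᶜ, ‖v - x‖ₑ ^ (s - 1) * ‖x - w‖ₑ ^ (a - 1) := by
    refine (enorm_integral_le_lintegral_enorm _).trans ?_
    rw [← lintegral_const_mul' _ _ (ENNReal.mul_ne_top hK₂ hK₁)]
    refine lintegral_mono fun x => ?_
    simp only
    rw [enorm_mul]
    calc _ ≤ (K₂ * ‖v - x‖ₑ ^ (s - 1)) * (K₁ * ‖x - w‖ₑ ^ (a - 1)) := by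
          gcongr
          · exact h₂ _
          · exact h₁ _
      _ = _ := by ring
  refine (add_le_add b1 b2).trans ?_
  rw [mul_add]
  gcongr
  · exact le_self_add
  · exact le_add_self

lemma enorm_rpow_mul_le {p q : ℝ} (hpq : p + q < 0) (z : ℝ) :
    ‖z‖ₑ ^ p * ‖z‖ₑ ^ q ≤ ‖z‖ₑ ^ (p + q) := by
  rcases eq_or_ne z 0 with rfl | hz
  · rw [enorm_zero, ENNReal.zero_rpow_of_neg hpq]; exact le_top
  · rw [ENNReal.rpow_add _ _ (enorm_ne_zero.2 hz) enorm_ne_top]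

lemma boundary_mul {p q : ℝ} (hp : 0 < p) (hq : 0 < q) (hpq : p + q < 1) :
    ∃ K : ℝ≥0∞, K ≠ ⊤ ∧ ∀ T : ℝ, 0 < T →
      ∫⁻ v in Icc (0:ℝ) T, ∫⁻ x in (Icc (0:ℝ) T)ᶜ, ‖v - x‖ₑ ^ (p - 1) * ‖x - v‖ₑ ^ (q - 1) ≤
        K * ENNReal.ofReal (T ^ (p + q)) := by
  obtain ⟨K, hK, h⟩ := lint_boundary (s := p + q) (by linarith) hpq
  refine ⟨K, hK, fun T hT => le_trans ?_ (h T hT)⟩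
  refine lintegral_mono fun v => lintegral_mono fun x => ?_
  rw [show ‖x - v‖ₑ = ‖v - x‖ₑ by rw [← enorm_neg, neg_sub]]
  have := enorm_rpow_mul_le (p := p - 1) (q := q - 1) (by linarith) (v - x)
  rwa [show p - 1 + (q - 1) = p + q - 2 by ring] at this

lemma swap_conv {a b : ℝ} (ha : 0 < a) (hb : 0 < b) (hab : a + b < 1) :
    ∃ K : ℝ≥0∞, K ≠ ⊤ ∧ ∀ (A I : Set ℝ) (p : ℝ → ℝ≥0∞), Measurable p → ∀ v : ℝ,
      ∫⁻ w in I, (∫⁻ x in A, p x * ‖x - w‖ₑ ^ (a - 1)) * ‖w - v‖ₑ ^ (b - 1) ≤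
        K * ∫⁻ x in A, p x * ‖x - v‖ₑ ^ (a + b - 1) := by
  obtain ⟨K, hK, h⟩ := conv_bound ha hb hab
  refine ⟨K, hK, fun A I p hp v => ?_⟩
  calc ∫⁻ w in I, (∫⁻ x in A, p x * ‖x - w‖ₑ ^ (a - 1)) * ‖w - v‖ₑ ^ (b - 1)
      = ∫⁻ w in I, ∫⁻ x in A, p x * ‖x - w‖ₑ ^ (a - 1) * ‖w - v‖ₑ ^ (b - 1) := by
        refine lintegral_congr fun w => ?_
        rw [lintegral_mul_const _ (by fun_prop)]
    _ = ∫⁻ x in A, ∫⁻ w in I, p x * ‖x - w‖ₑ ^ (a - 1) * ‖w - v‖ₑ ^ (b - 1) := by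
        rw [lintegral_lintegral_swap]
        have : Measurable (Function.uncurry fun w x : ℝ =>
            p x * ‖x - w‖ₑ ^ (a - 1) * ‖w - v‖ₑ ^ (b - 1)) := by
          simp only [Function.uncurry_def]; fun_prop
        exact this.aemeasurable
    _ ≤ ∫⁻ x in A, K * (p x * ‖x - v‖ₑ ^ (a + b - 1)) := by
        refine lintegral_mono fun x => ?_
        simp only [mul_assoc]
        rw [lintegral_const_mul _ (by fun_prop)]
        calc _ ≤ p x * (K * ‖x - v‖ₑ ^ (a + b - 1)) := by
              gcongr
              exact (setLIntegral_le_lintegral _ _).trans (h x v)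
          _ = _ := by ring
    _ = _ := lintegral_const_mul' _ _ hK

lemma measurable_defect {G : ℝ → ℝ → ℂ} (hG : Continuous (Function.uncurry G)) {g : ℝ → ℝ}
    (hg : Integrable g) :
    Measurable (fun p : ℝ × ℝ => ‖G p.1 p.2 - hatR g (p.1 - p.2)‖ₑ) := by
  have hgc := hatR_continuous hg
  have h1 : Continuous (fun p : ℝ × ℝ => G p.1 p.2) := hG
  have : Continuous (fun p : ℝ × ℝ => G p.1 p.2 - hatR g (p.1 - p.2)) := by fun_prop
  exact this.measurable.enorm

lemma defect_diag {a s : ℝ} (ha : 0 < a) (hs : 0 < s) (has : s + a < 1) {f g : ℝ → ℝ}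
    (hf : Cls a f) (hg : Cls s g) :
    ∃ K : ℝ≥0∞, K ≠ ⊤ ∧ ∀ T : ℝ, 0 < T → ∀ G : ℝ → ℝ → ℂ, Continuous (Function.uncurry G) →
      ∫⁻ u in Icc (0:ℝ) T, ‖stepK T f G u u - hatR (fun x => 2 * π * (g x * f x)) (u - u)‖ₑ ≤
        K * (ENNReal.ofReal (T ^ (s + a)) + ∫⁻ v in Icc (0:ℝ) T, ∫⁻ x in Icc (0:ℝ) T,
          ‖G v x - hatR g (v - x)‖ₑ * ‖x - v‖ₑ ^ (a - 1)) := by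
  obtain ⟨K₁, hK₁, h₁⟩ := step_bound ha hs has hf hg
  obtain ⟨K₂, hK₂, h₂⟩ := boundary_mul hs ha has
  refine ⟨K₁ * (K₂ + 1), ENNReal.mul_ne_top hK₁ (by simp [hK₂]), fun T hT G hG => ?_⟩
  have hE := measurable_defect hG (hg.integrable (by linarith))
  refine (lintegral_mono fun u => h₁ T G hG u u).trans ?_
  rw [lintegral_const_mul' _ _ hK₁, mul_assoc]
  refine mul_le_mul_right ?_ _
  rw [lintegral_add_left]
  · rw [add_comm]
    refine (add_le_add_left (h₂ T hT) _).trans ?_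
    rw [mul_add]
    gcongr
    · exact le_self_add
    · exact le_mul_of_one_le_left zero_le le_add_self
  · have : Measurable (fun p : ℝ × ℝ => ‖G p.1 p.2 - hatR g (p.1 - p.2)‖ₑ * ‖p.2 - p.1‖ₑ ^ (a - 1)) :=
      hE.mul (by fun_prop)
    exact this.lintegral_prod_right'

lemma defect_step {a s b : ℝ} (ha : 0 < a) (hs : 0 < s) (hb : 0 < b) (hsum : s + a + b < 1)
    {f g : ℝ → ℝ} (hf : Cls a f) (hg : Cls s g) :
    ∃ K : ℝ≥0∞, K ≠ ⊤ ∧ ∀ T : ℝ, 0 < T → ∀ G : ℝ → ℝ → ℂ, Continuous (Function.uncurry G) →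
      ∫⁻ v in Icc (0:ℝ) T, ∫⁻ w in Icc (0:ℝ) T,
        ‖stepK T f G v w - hatR (fun x => 2 * π * (g x * f x)) (v - w)‖ₑ * ‖w - v‖ₑ ^ (b - 1) ≤
        K * (ENNReal.ofReal (T ^ (s + (a + b))) + ∫⁻ v in Icc (0:ℝ) T, ∫⁻ x in Icc (0:ℝ) T,
          ‖G v x - hatR g (v - x)‖ₑ * ‖x - v‖ₑ ^ (a + b - 1)) := by
  obtain ⟨K₁, hK₁, h₁⟩ := step_bound ha hs (by linarith) hf hg
  obtain ⟨K₂, hK₂, h₂⟩ := boundary_mul (p := s) (q := a + b) hs (by linarith) (by linarith)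
  obtain ⟨K₃, hK₃, h₃⟩ := swap_conv ha hb (by linarith)
  refine ⟨K₁ * (K₃ * (K₂ + 1)), ENNReal.mul_ne_top hK₁ (ENNReal.mul_ne_top hK₃ (by simp [hK₂])),
    fun T hT G hG => ?_⟩
  have hE := measurable_defect hG (hg.integrable (by linarith))
  have inner : ∀ v : ℝ, ∫⁻ w in Icc (0:ℝ) T,
        ‖stepK T f G v w - hatR (fun x => 2 * π * (g x * f x)) (v - w)‖ₑ * ‖w - v‖ₑ ^ (b - 1) ≤
      K₁ * (K₃ * ((∫⁻ x in Icc (0:ℝ) T, ‖G v x - hatR g (v - x)‖ₑ * ‖x - v‖ₑ ^ (a + b - 1)) +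
        ∫⁻ x in (Icc (0:ℝ) T)ᶜ, ‖v - x‖ₑ ^ (s - 1) * ‖x - v‖ₑ ^ (a + b - 1))) := by
    intro v
    have hEv : Measurable (fun x : ℝ => ‖G v x - hatR g (v - x)‖ₑ) :=
      hE.comp (by fun_prop : Measurable (fun x : ℝ => (v, x)))
    have q1 := h₃ (Icc (0:ℝ) T) (Icc (0:ℝ) T) _ hEv v
    have q2 := h₃ (Icc (0:ℝ) T)ᶜ (Icc (0:ℝ) T) (fun x => ‖v - x‖ₑ ^ (s - 1)) (by fun_prop) v
    rw [mul_add]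
    refine le_trans ?_ (mul_le_mul_right (add_le_add q1 q2) K₁)
    rw [← lintegral_add_left, ← lintegral_const_mul' _ _ hK₁]
    · refine lintegral_mono fun w => ?_
      simp only
      rw [← add_mul, ← mul_assoc]
      exact mul_le_mul_left (h₁ T G hG v w) _
    · refine Measurable.mul ?_ (by fun_prop)
      have : Measurable (fun q : ℝ × ℝ => ‖G v q.2 - hatR g (v - q.2)‖ₑ * ‖q.2 - q.1‖ₑ ^ (a - 1)) :=
        (hEv.comp measurable_snd).mul (by fun_prop)
      exact this.lintegral_prod_right'
  refine (lintegral_mono inner).trans ?_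
  rw [lintegral_const_mul' _ _ hK₁, lintegral_const_mul' _ _ hK₃, mul_assoc, mul_assoc]
  refine mul_le_mul_right (mul_le_mul_right ?_ _) _
  rw [lintegral_add_left]
  · rw [add_comm]
    refine (add_le_add_left (h₂ T hT) _).trans ?_
    rw [mul_add]
    gcongr
    · exact le_self_add
    · exact le_mul_of_one_le_left zero_le le_add_self
  · have : Measurable (fun p : ℝ × ℝ =>
        ‖G p.1 p.2 - hatR g (p.1 - p.2)‖ₑ * ‖p.2 - p.1‖ₑ ^ (a + b - 1)) :=
      hE.mul (by fun_prop)
    exact this.lintegral_prod_right'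

/-- The chain integral. -/
def chain (n : ℕ) (T : ℝ) (h : Fin n → ℝ → ℝ) (G : ℝ → ℝ → ℂ) : ℂ :=
  ∫ x in Set.univ.pi (fun _ : Fin (n + 1) => Icc (0 : ℝ) T),
    (∏ i : Fin n, hatR (h i) (x i.castSucc - x i.succ)) * G (x (Fin.last n)) (x 0)

lemma chain_zero (T : ℝ) (h : Fin 0 → ℝ → ℝ) (G : ℝ → ℝ → ℂ) :
    chain 0 T h G = ∫ u in Icc (0:ℝ) T, G u u := by
  have hmp := (volume_preserving_funUnique (Fin 1) ℝ)
  have := hmp.setIntegral_preimage_emb (MeasurableEquiv.measurableEmbedding _)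
    (fun u => G u u) (Icc (0:ℝ) T)
  rw [← this, chain]
  have hs : (MeasurableEquiv.funUnique (Fin 1) ℝ) ⁻¹' (Icc 0 T) =
      Set.univ.pi (fun _ : Fin 1 => Icc (0 : ℝ) T) := by
    ext x
    constructor
    · intro hx i _
      rw [Subsingleton.elim i 0]
      exact hx
    · intro hx
      exact hx 0 (mem_univ _)
  rw [← hs]
  congr 1
  ext x
  simp [MeasurableEquiv.funUnique]

lemma chain_succ (n : ℕ) (T : ℝ) (h : Fin (n + 1) → ℝ → ℝ) (G : ℝ → ℝ → ℂ)
    (hh : ∀ i, Integrable (h i)) (hG : Continuous (Function.uncurry G)) :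
    chain (n + 1) T h G = chain n T (fun i => h i.succ) (stepK T (h 0) G) := by
  have hp : ∀ p, (MeasurableEquiv.piFinSuccAbove (fun _ : Fin (n + 2) => ℝ) 0).symm p =
      (Fin.cons p.1 p.2 : Fin (n + 2) → ℝ) := by
    intro p
    simp [MeasurableEquiv.piFinSuccAbove]
    rfl
  have hmp := (volume_preserving_piFinSuccAbove (fun _ : Fin (n + 2) => ℝ) 0).symm _
  have hc : ∀ i, Continuous (hatR (h i)) := fun i => hatR_continuous (hh i)
  have := hmp.setIntegral_preimage_emb (MeasurableEquiv.measurableEmbedding _)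
    (fun x : Fin (n + 2) → ℝ => (∏ i : Fin (n + 1), hatR (h i) (x i.castSucc - x i.succ)) *
      G (x (Fin.last (n + 1))) (x 0)) (Set.univ.pi (fun _ : Fin (n + 2) => Icc (0 : ℝ) T))
  rw [chain, ← this]
  have hs : (MeasurableEquiv.piFinSuccAbove (fun _ : Fin (n + 2) => ℝ) 0).symm ⁻¹'
      (Set.univ.pi (fun _ : Fin (n + 2) => Icc (0 : ℝ) T)) =
      Icc (0:ℝ) T ×ˢ Set.univ.pi (fun _ : Fin (n + 1) => Icc (0 : ℝ) T) := by
    ext p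
    rw [mem_preimage, hp]
    constructor
    · intro hx
      exact ⟨hx 0 (mem_univ _), fun i _ => hx i.succ (mem_univ _)⟩
    · rintro ⟨h1, h2⟩ i _
      refine Fin.cases ?_ (fun j => ?_) i
      · exact h1
      · exact h2 j (mem_univ _)
  rw [hs, Measure.volume_eq_prod]
  have hInteg : IntegrableOn (fun p : ℝ × (Fin (n + 1) → ℝ) =>
      (∏ i : Fin (n + 1), hatR (h i) ((Fin.cons p.1 p.2 : Fin (n + 2) → ℝ) i.castSucc - p.2 i)) *
        G (p.2 (Fin.last n)) p.1) (Icc (0:ℝ) T ×ˢ Set.univ.pi (fun _ : Fin (n + 1) => Icc (0 : ℝ) T))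
      (volume.prod volume) := by
    refine ContinuousOn.integrableOn_compact
      (isCompact_Icc.prod (isCompact_univ_pi fun _ => isCompact_Icc)) ?_
    refine Continuous.continuousOn ?_
    refine Continuous.mul ?_ ?_
    · refine continuous_finsetProd _ fun i _ => (hc i).comp (Continuous.sub ?_ (by fun_prop))
      refine Fin.cases ?_ (fun j => ?_) i
      · simpa using continuous_fst
      · simp only [← Fin.succ_castSucc, Fin.cons_succ]; fun_prop
    · exact hG.comp (by fun_prop : Continuous fun p : ℝ × (Fin (n + 1) → ℝ) => (p.2 (Fin.last n), p.1))
  have heq : ∀ p : ℝ × (Fin (n + 1) → ℝ),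
      (∏ i : Fin (n + 1), hatR (h i) ((MeasurableEquiv.piFinSuccAbove (fun _ : Fin (n + 2) => ℝ) 0).symm p i.castSucc -
        (MeasurableEquiv.piFinSuccAbove (fun _ : Fin (n + 2) => ℝ) 0).symm p i.succ)) *
      G ((MeasurableEquiv.piFinSuccAbove (fun _ : Fin (n + 2) => ℝ) 0).symm p (Fin.last (n + 1)))
        ((MeasurableEquiv.piFinSuccAbove (fun _ : Fin (n + 2) => ℝ) 0).symm p 0) =
      (∏ i : Fin (n + 1), hatR (h i) ((Fin.cons p.1 p.2 : Fin (n + 2) → ℝ) i.castSucc - p.2 i)) *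
        G (p.2 (Fin.last n)) p.1 := by
    intro p
    rw [hp, ← Fin.succ_last]
    simp only [Fin.cons_succ, Fin.cons_zero]
  simp only [heq]
  rw [setIntegral_prod _ hInteg, integral_integral_swap (by rw [Measure.prod_restrict]; exact hInteg),
    chain]
  refine setIntegral_congr_fun (MeasurableSet.univ_pi fun _ => measurableSet_Icc) fun y _ => ?_
  simp only
  rw [stepK, ← integral_const_mul]
  congr 1; ext x
  rw [Fin.prod_univ_succ]
  simp only [Fin.castSucc_zero, Fin.cons_zero, ← Fin.succ_castSucc, Fin.cons_succ]
  ring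

/-! ### Iterating the chain -/

lemma hatR_zero (g : ℝ → ℝ) : hatR g 0 = ((∫ x, g x : ℝ) : ℂ) := by
  unfold hatR
  rw [← integral_complex_ofReal]
  simp

lemma chain_base {T : ℝ} (hT : 0 < T) (g : ℝ → ℝ) (G : ℝ → ℝ → ℂ)
    (hG : Continuous (Function.uncurry G)) :
    ‖(∫ u in Icc (0:ℝ) T, G u u) - ((T * ∫ x, g x : ℝ) : ℂ)‖ₑ ≤
      ∫⁻ u in Icc (0:ℝ) T, ‖G u u - hatR g (u - u)‖ₑ := by
  have h1 : ((T * ∫ x, g x : ℝ) : ℂ) = ∫ u in Icc (0:ℝ) T, hatR g (u - u) := by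
    simp only [sub_self, hatR_zero]
    rw [setIntegral_const]
    simp [hT.le]
  have hc : Continuous fun u : ℝ => G u u :=
    hG.comp (by fun_prop : Continuous fun u : ℝ => (u, u))
  rw [h1, ← integral_sub]
  · exact enorm_integral_le_lintegral_enorm _
  · exact hc.continuousOn.integrableOn_compact isCompact_Icc
  · simp only [sub_self]
    exact continuousOn_const.integrableOn_compact isCompact_Icc

lemma chain_claim (k : ℕ) : ∀ (h : Fin (k + 1) → ℝ → ℝ) (σ : Fin (k + 1) → ℝ) (g : ℝ → ℝ) (s : ℝ),
    (∀ i, 0 < σ i) → (∀ i, Cls (σ i) (h i)) → 0 < s → Cls s g → ∑ i, σ i + s < 1 →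
    ∃ K : ℝ≥0∞, K ≠ ⊤ ∧ ∀ T : ℝ, 0 < T → ∀ G : ℝ → ℝ → ℂ, Continuous (Function.uncurry G) →
      ‖chain (k + 1) T h G - ((T * ((2 * π) ^ (k + 1) * ∫ x, g x * ∏ i, h i x) : ℝ) : ℂ)‖ₑ ≤
        K * (ENNReal.ofReal (T ^ (∑ i, σ i + s)) +
          ∫⁻ v in Icc (0:ℝ) T, ∫⁻ w in Icc (0:ℝ) T,
            ‖G v w - hatR g (v - w)‖ₑ * ‖w - v‖ₑ ^ (∑ i, σ i - 1)) := by
  induction k with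
  | zero =>
    intro h σ g s hσ hh hs hg hsum
    have hσ0 : ∑ i, σ i = σ 0 := Fin.sum_univ_one σ
    have hp0 : ∀ x, ∏ i, h i x = h 0 x := fun x => Fin.prod_univ_one fun i => h i x
    simp only [hσ0, hp0, zero_add] at hsum ⊢
    obtain ⟨K, hK, H⟩ := defect_diag (hσ 0) hs (by linarith) (hh 0) hg
    refine ⟨K, hK, fun T hT G hG => ?_⟩
    have hInteg : ∀ i, Integrable (h i) := fun i => by
      rw [Subsingleton.elim (α := Fin 1) i 0]; exact Cls.integrable (by linarith) (hh 0)
    rw [chain_succ 0 T h G hInteg hG, chain_zero]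
    have h2 := chain_base hT (fun x => 2 * π * (g x * h 0 x)) _
      (stepK_continuous (T := T) (hInteg 0) hG)
    rw [integral_const_mul] at h2
    rw [pow_one]
    refine h2.trans ((H T hT G hG).trans (le_of_eq ?_))
    rw [add_comm s]
  | succ k ih =>
    intro h σ g s hσ hh hs hg hsum
    have hS := Fin.sum_univ_succ σ
    have hpos : 0 < ∑ i : Fin (k + 1), σ i.succ :=
      Finset.sum_pos (fun i _ => hσ _) Finset.univ_nonempty
    have hle : ∀ i, σ i < 1 := fun i => by
      have := Finset.single_le_sum (f := σ) (fun i _ => (hσ i).le) (Finset.mem_univ i)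
      linarith
    have hInteg : ∀ i, Integrable (h i) := fun i => Cls.integrable (hle i) (hh i)
    have hg' : Cls (s + σ 0) (fun x => 2 * π * (g x * h 0 x)) :=
      Cls.const_mul (Cls.mul hg (hh 0) (hσ 0) (by linarith)) (by positivity)
    obtain ⟨K₁, hK₁, H₁⟩ := ih (fun i => h i.succ) (fun i => σ i.succ) _ (s + σ 0)
      (fun i => hσ _) (fun i => hh _) (by linarith [hσ 0]) hg' (by linarith)
    obtain ⟨K₂, hK₂, H₂⟩ := defect_step (hσ 0) hs hpos (by linarith) (hh 0) hg
    refine ⟨K₁ * (1 + K₂), ENNReal.mul_ne_top hK₁ (by simp [hK₂]), fun T hT G hG => ?_⟩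
    rw [chain_succ (k + 1) T h G hInteg hG]
    have h1 := H₁ T hT _ (stepK_continuous (T := T) (hInteg 0) hG)
    have h2 := H₂ T hT G hG
    have e1 : ∑ i : Fin (k + 1), σ i.succ + (s + σ 0) = ∑ i, σ i + s := by rw [hS]; ring
    have e2 : s + (σ 0 + ∑ i : Fin (k + 1), σ i.succ) = ∑ i, σ i + s := by rw [hS]; ring
    have e3 : (2 * π) ^ (k + 1) * ∫ x, 2 * π * (g x * h 0 x) * ∏ i : Fin (k + 1), h i.succ x =
        (2 * π) ^ (k + 1 + 1) * ∫ x, g x * ∏ i, h i x := by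
      rw [pow_succ _ (k + 1), mul_assoc ((2 * π) ^ (k + 1)), ← integral_const_mul (2 * π)]
      congr 1
      refine integral_congr_ae (Eventually.of_forall fun x => ?_)
      simp only
      rw [Fin.prod_univ_succ (fun i => h i x)]
      ring
    rw [e1, e3] at h1
    rw [e2, ← hS] at h2
    refine h1.trans ?_
    rw [mul_assoc]
    gcongr
    refine (add_le_add_right h2 _).trans ?_
    rw [add_mul, one_mul]
    gcongr
    exact le_self_add

lemma cls_of_bounds {f : ℝ → ℝ} {σ δ C : ℝ} (hσ : σ < 1) (hδ : 1 < δ) (hC : 0 < C)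
    (hdiff : ∀ x : ℝ, x ≠ 0 → DifferentiableAt ℝ f x)
    (hb₁ : ∀ x : ℝ, x ≠ 0 → |x| ≤ 1 → |f x| ≤ C * |x| ^ (-σ))
    (hb₂ : ∀ x : ℝ, x ≠ 0 → |x| ≤ 1 → |deriv f x| ≤ C * |x| ^ (-σ - 1))
    (hb₃ : ∀ x : ℝ, 1 < |x| → |f x| ≤ C * |x| ^ (-δ))
    (hb₄ : ∀ x : ℝ, 1 < |x| → |deriv f x| ≤ C * |x| ^ (-δ - 1)) : Cls σ f := by
  refine ⟨hdiff, C, δ, hC, hδ, fun x hx => ?_⟩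
  have hx0 : 0 < |x| := abs_pos.2 hx
  rcases le_or_gt |x| 1 with h1 | h1
  · refine ⟨hb₁ x hx h1, hb₂ x hx h1, (hb₁ x hx h1).trans ?_⟩
    exact mul_le_mul_of_nonneg_left
      (Real.rpow_le_rpow_of_exponent_ge hx0 h1 (by linarith)) hC.le
  · refine ⟨(hb₃ x h1).trans ?_, (hb₄ x h1).trans ?_, hb₃ x h1⟩
    · exact mul_le_mul_of_nonneg_left
        (Real.rpow_le_rpow_of_exponent_le h1.le (by linarith)) hC.le
    · exact mul_le_mul_of_nonneg_left
        (Real.rpow_le_rpow_of_exponent_le h1.le (by linarith)) hC.le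

lemma SW_eq_chain (k : ℕ) (h : Fin (k + 2) → ℝ → ℝ) (T : ℝ) :
    SW (k + 2) h T = (T : ℂ)⁻¹ * chain (k + 1) T (fun i => h i.castSucc)
      (fun v w => hatR (h (Fin.last (k + 1))) (v - w)) := by
  rw [SW, chain]
  congr 2
  ext u
  rw [Fin.prod_univ_castSucc]
  simp only [Fin.coeSucc_eq_succ, Fin.last_add_one]

lemma ΔW_bound (k : ℕ) (h : Fin (k + 2) → ℝ → ℝ) (σ : Fin (k + 2) → ℝ)
    (hσ : ∀ i, 0 < σ i) (hh : ∀ i, Cls (σ i) (h i)) (hsum : ∑ i, σ i < 1) :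
    ∃ K : ℝ, ∀ T : ℝ, 0 < T → ΔW (k + 2) h T ≤ K * T ^ (∑ i, σ i - 1) := by
  have hS := Fin.sum_univ_castSucc σ
  have hlast : σ (Fin.last (k + 1)) < 1 := by
    have := Finset.single_le_sum (f := σ) (fun i _ => (hσ i).le)
      (Finset.mem_univ (Fin.last (k + 1)))
    linarith
  obtain ⟨K, hK, H⟩ := chain_claim k (fun i => h i.castSucc) (fun i => σ i.castSucc)
    (h (Fin.last (k + 1))) (σ (Fin.last (k + 1))) (fun i => hσ _) (fun i => hh _) (hσ _) (hh _)
    (by linarith)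
  refine ⟨K.toReal, fun T hT => ?_⟩
  have hc : Continuous (hatR (h (Fin.last (k + 1)))) :=
    hatR_continuous (Cls.integrable hlast (hh _))
  have h1 := H T hT (fun v w => hatR (h (Fin.last (k + 1))) (v - w))
    (hc.comp (by fun_prop : Continuous fun p : ℝ × ℝ => p.1 - p.2))
  simp only [sub_self, enorm_zero, zero_mul, lintegral_zero, add_zero, ← hS] at h1
  have e1 : ∀ x, h (Fin.last (k + 1)) x * ∏ i : Fin (k + 1), h i.castSucc x = ∏ i, h i x := by
    intro x
    rw [Fin.prod_univ_castSucc (fun i => h i x), mul_comm]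
  simp only [e1] at h1
  have h2 := ENNReal.toReal_mono (ENNReal.mul_ne_top hK ENNReal.ofReal_ne_top) h1
  rw [toReal_enorm, ENNReal.toReal_mul, ENNReal.toReal_ofReal (by positivity)] at h2
  rw [ΔW, SW_eq_chain]
  have hT' : (T : ℂ) ≠ 0 := by exact_mod_cast hT.ne'
  have e2 : ∀ (a : ℂ) (b : ℝ), (T : ℂ)⁻¹ * a - (b : ℂ) = (T : ℂ)⁻¹ * (a - ((T * b : ℝ) : ℂ)) := by
    intro a b
    push_cast
    field_simp
  rw [e2, norm_mul, norm_inv, Complex.norm_real, Real.norm_of_nonneg hT.le,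
    Real.rpow_sub_one hT.ne']
  calc _ ≤ T⁻¹ * (K.toReal * T ^ (∑ i, σ i)) := by
        gcongr
        exact h2
    _ = _ := by ring

theorem stmt13 (m : ℕ) [NeZero m] (hm : 2 ≤ m) (h : Fin m → ℝ → ℝ)
    (heven : ∀ i, ∀ x : ℝ, h i (-x) = h i x)
    (σ δ C : Fin m → ℝ)
    (hσ : ∀ i, 0 < σ i) (hδ : ∀ i, 1 < δ i) (hC : ∀ i, 0 < C i)
    (hσsum : ∑ i, σ i < 1)
    (hdiff : ∀ i, ∀ x : ℝ, x ≠ 0 → DifferentiableAt ℝ (h i) x)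
    (hb₁ : ∀ i, ∀ x : ℝ, x ≠ 0 → |x| ≤ 1 → |h i x| ≤ C i * |x| ^ (-(σ i)))
    (hb₂ : ∀ i, ∀ x : ℝ, x ≠ 0 → |x| ≤ 1 →
      |deriv (h i) x| ≤ C i * |x| ^ (-(σ i) - 1))
    (hb₃ : ∀ i, ∀ x : ℝ, 1 < |x| → |h i x| ≤ C i * |x| ^ (-(δ i)))
    (hb₄ : ∀ i, ∀ x : ℝ, 1 < |x| →
      |deriv (h i) x| ≤ C i * |x| ^ (-(δ i) - 1)) :
    ∀ ε > (0 : ℝ),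
      (fun T : ℝ => ΔW m h T) =O[atTop]
        fun T : ℝ => T ^ (-((1 - ∑ i, σ i) / m) + ε) := by
  intro ε hε
  obtain ⟨k, rfl⟩ : ∃ k, m = k + 2 := ⟨m - 2, by omega⟩
  have hle : ∀ i, σ i < 1 := fun i => by
    have := Finset.single_le_sum (f := σ) (fun i _ => (hσ i).le) (Finset.mem_univ i)
    linarith
  obtain ⟨K, hK⟩ := ΔW_bound k h σ hσ (fun i => cls_of_bounds (hle i) (hδ i) (hC i) (hdiff i)
    (hb₁ i) (hb₂ i) (hb₃ i) (hb₄ i)) hσsum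
  refine IsBigO.of_bound |K| ?_
  filter_upwards [eventually_ge_atTop (1:ℝ)] with T hT
  have hT0 : 0 < T := by linarith
  have h1 : ‖ΔW (k + 2) h T‖ = ΔW (k + 2) h T := by
    rw [Real.norm_of_nonneg]
    exact norm_nonneg _
  rw [h1, Real.norm_of_nonneg (by positivity)]
  refine (hK T hT0).trans ?_
  refine mul_le_mul (le_abs_self K) ?_ (by positivity) (abs_nonneg K)
  refine Real.rpow_le_rpow_of_exponent_le hT ?_
  have h2 : (1 - ∑ i, σ i) / ((k + 2 : ℕ) : ℝ) ≤ 1 - ∑ i, σ i := by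
    refine div_le_self (by linarith) ?_
    push_cast
    linarith [(Nat.cast_nonneg k : (0:ℝ) ≤ k)]
  linarith
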